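/- For every integer N and all y, z ∈ K, the bilinear difference equation holds: q^{−2(N+1)}·y·φ_N(y/q,z)·φ_N(y,z) + q^{−(N+1)}·(1 + z)·φ_N(y,qz)·φ_N(y/q,z/q) = −((1 − q^{−(2N+1)})/(1 − q))·φ_{N−1}(y,z)·φ_{N+1}(y/q,z). -/

import Mathlib

open Matrix Finset

/-- The Jacobi--Trudi type determinant: `det (p (n - 2i + j) y z)_{0 ≤ i,j ≤ n-1}`. -/
noncomputable def phiAux {K : Type*} [Field K] (p : ℤ → K → K → K) (n : ℕ) (y z : K) : K :=
  Matrix.det (Matrix.of fun i j : Fin n => p ((n : ℤ) - 2 * ((i : ℕ) : ℤ) + ((j : ℕ) : ℤ)) y z)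

/-- The polynomials `φ_N(y,z)`: for `N ≥ 0` the Jacobi--Trudi determinant (with `φ_0 = 1`
as the empty determinant), and for `N < 0` we set `φ_N = (-1)^(N(N+1)/2) φ_(-N-1)`. -/
noncomputable def phi {K : Type*} [Field K] (p : ℤ → K → K → K) (N : ℤ) (y z : K) : K :=
  if 0 ≤ N then phiAux p N.toNat y z
  else (-1 : K) ^ (N * (N + 1) / 2) * phiAux p (-N - 1).toNat y z

/-- The sequence obtained from `h` by multiplying its generating function by `1 + c t`. -/
def shiftSeq {K : Type*} [Field K] (c : K) (h : ℤ → K) : ℤ → K := fun k => h k + c * h (k - 1)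

/-- The staircase Jacobi-Trudi determinant of a sequence, with rows and columns exchanged. -/
def stairDet {K : Type*} [Field K] (h : ℤ → K) (n : ℕ) : K :=
  Matrix.det (Matrix.of fun i j : Fin n => h ((n : ℤ) + (i : ℕ) - 2 * (j : ℕ)))

section Determinants

variable {K : Type*} [Field K]

lemma phiAux_eq_stairDet (p : ℤ → K → K → K) (n : ℕ) (y z : K) :
    phiAux p n y z = stairDet (fun k => p k y z) n := by
  unfold phiAux stairDet
  rw [← Matrix.det_transpose]
  congr 1
  ext i j
  simp only [Matrix.transpose_apply, Matrix.of_apply]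
  congr 1
  ring

/-- The determinant with two distinguished rows on top of a fixed block of rows. -/
def twoRowDet {m : ℕ} (X : Fin m → Fin (m + 2) → K) (α β : Fin (m + 2) → K) : K :=
  Matrix.det (Matrix.of (vecCons α (vecCons β X)))

lemma twoRowDet_swap {m : ℕ} (X : Fin m → Fin (m + 2) → K) (α β : Fin (m + 2) → K) :
    twoRowDet X α β = -twoRowDet X β α := by
  unfold twoRowDet
  have h := Matrix.det_permute (Equiv.swap (0 : Fin (m + 2)) 1)
    (Matrix.of (vecCons β (vecCons α X)))
  rw [Equiv.Perm.sign_swap (by simp)] at h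
  have e : (Matrix.of (vecCons β (vecCons α X))).submatrix (Equiv.swap (0 : Fin (m + 2)) 1) id
      = Matrix.of (vecCons α (vecCons β X)) := by
    ext i j
    refine Fin.cases ?_ (fun i => Fin.cases ?_ (fun i => ?_) i) i
    · simp
    · simp [Equiv.swap_apply_right]
    · rw [Matrix.submatrix_apply, Equiv.swap_apply_of_ne_of_ne (Fin.succ_ne_zero _)
        (by simp [Fin.ext_iff])]
      simp
  rw [e] at h
  simpa using h

/-- The determinant with a variable row put on top of a fixed block of rows is linear in that row. -/
lemma det_vecCons_sum {n : ℕ} {ι : Type*} (s : Finset ι) (Y : Fin n → Fin (n + 1) → K)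
    (c : ι → K) (v : ι → Fin (n + 1) → K) :
    Matrix.det (Matrix.of (vecCons (∑ i ∈ s, c i • v i) Y))
      = ∑ i ∈ s, c i * Matrix.det (Matrix.of (vecCons (v i) Y)) := by
  simp only [Matrix.det_succ_row_zero, Finset.mul_sum]
  rw [Finset.sum_comm]
  refine Finset.sum_congr rfl fun j _ => ?_
  have e : ∀ w : Fin (n + 1) → K,
      (Matrix.of (vecCons w Y)).submatrix Fin.succ j.succAbove
        = (Matrix.of Y).submatrix id j.succAbove := by
    intro w; ext a b; simp
  simp only [e, Matrix.of_apply, cons_val_zero, Finset.sum_apply, Pi.smul_apply, smul_eq_mul,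
    Finset.mul_sum, Finset.sum_mul]
  exact Finset.sum_congr rfl fun i _ => by ring

/-- The three-term Plücker relation. -/
lemma twoRowDet_plucker {m : ℕ} (X : Fin m → Fin (m + 2) → K) (α β γ δ : Fin (m + 2) → K) :
    twoRowDet X α β * twoRowDet X γ δ - twoRowDet X α γ * twoRowDet X β δ
      + twoRowDet X α δ * twoRowDet X β γ = 0 := by
  set A : Matrix (Fin (m + 2)) (Fin (m + 2)) K := Matrix.of (vecCons α (vecCons β X)) with hA
  have hc : Aᵀ *ᵥ Matrix.cramer Aᵀ γ = A.det • γ := by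
    rw [Matrix.mulVec_cramer, Matrix.det_transpose]
  have hsum : ∑ i, Matrix.cramer Aᵀ γ i • A i = A.det • γ := by
    rw [← hc]
    ext j
    simp [Matrix.mulVec, dotProduct, mul_comm]
  have hdet := det_vecCons_sum Finset.univ (vecCons δ X) (Matrix.cramer Aᵀ γ) A
  have hg := det_vecCons_sum (Finset.univ : Finset (Fin 1)) (vecCons δ X)
    (fun _ => A.det) (fun _ => γ)
  simp only [Finset.univ_unique, Finset.sum_singleton] at hg
  rw [hsum, hg, Fin.sum_univ_succ, Fin.sum_univ_succ] at hdet
  have hz : ∀ i : Fin m, Matrix.det (Matrix.of (vecCons (A i.succ.succ) (vecCons δ X))) = 0 := by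
    intro i
    refine Matrix.det_zero_of_row_eq (i := 0) (j := i.succ.succ) (Fin.succ_ne_zero _).symm ?_
    ext j
    simp [hA]
  simp only [hz, mul_zero, Finset.sum_const_zero, add_zero] at hdet
  have h0 : Matrix.cramer Aᵀ γ 0 = twoRowDet X γ β := by
    rw [Matrix.cramer_transpose_apply]
    unfold twoRowDet
    congr 1
    ext i j
    refine Fin.cases ?_ (fun i => ?_) i
    · simp
    · rw [Matrix.updateRow_ne (Fin.succ_ne_zero _)]
      simp [hA]
  have h1 : Matrix.cramer Aᵀ γ (Fin.succ 0) = twoRowDet X α γ := by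
    rw [Matrix.cramer_transpose_apply]
    unfold twoRowDet
    congr 1
    ext i j
    refine Fin.cases ?_ (fun i => Fin.cases ?_ (fun i => ?_) i) i
    · rw [Matrix.updateRow_ne (Fin.succ_ne_zero _).symm]
      simp [hA]
    · rw [Matrix.updateRow_self]; simp
    · rw [Matrix.updateRow_ne (by simp [Fin.ext_iff])]
      simp [hA]
  rw [h0, h1, twoRowDet_swap X γ β] at hdet
  have e0 : A 0 = α := rfl
  have e1 : A (Fin.succ 0) = β := rfl
  rw [e0, e1] at hdet
  change twoRowDet X α β * twoRowDet X γ δ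
    = -twoRowDet X β γ * twoRowDet X α δ + twoRowDet X α γ * twoRowDet X β δ at hdet
  linear_combination hdet

lemma twoRowDet_eq_sign_mul_snoc {m : ℕ} (X : Fin m → Fin (m + 2) → K) (δ : Fin (m + 2) → K) :
    ∃ σ : K, σ ≠ 0 ∧ ∀ α : Fin (m + 2) → K, twoRowDet X α δ
      = σ * Matrix.det (Matrix.of (vecCons α (Fin.snoc (α := fun _ => Fin (m + 2) → K) X δ))) := by
  refine ⟨(-1) ^ m, pow_ne_zero _ (by simp), fun α => ?_⟩
  unfold twoRowDet
  rw [Matrix.det_succ_row_zero, Matrix.det_succ_row_zero, Finset.mul_sum]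
  refine Finset.sum_congr rfl fun j _ => ?_
  have e : (Matrix.of (vecCons α (Fin.snoc (α := fun _ => Fin (m + 2) → K) X δ))).submatrix
        Fin.succ j.succAbove
      = ((Matrix.of (vecCons α (vecCons δ X))).submatrix Fin.succ j.succAbove).submatrix
        (finRotate (m + 1)) id := by
    ext a b
    simp only [Matrix.submatrix_apply, Matrix.of_apply, cons_val_succ, id]
    rw [Fin.snoc_eq_cons_rotate]
    rfl
  rw [e, Matrix.det_permute, sign_finRotate]
  have hs : ((-1 : K) ^ m) * (-1) ^ m = 1 := by rw [← mul_pow]; simp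
  simp only [Matrix.of_apply, cons_val_zero]
  push_cast
  linear_combination (-(-1 : K) ^ (j : ℕ) * α j *
    ((Matrix.of (vecCons α (vecCons δ X))).submatrix Fin.succ j.succAbove).det) * hs

/-- Expansion of a determinant whose first row is the first basis vector. -/
lemma det_vecCons_single {n : ℕ} (Y : Fin n → Fin (n + 1) → K) :
    Matrix.det (Matrix.of (vecCons (Pi.single 0 1) Y))
      = Matrix.det (Matrix.of fun i j : Fin n => Y i j.succ) := by
  rw [Matrix.det_succ_row_zero, Finset.sum_eq_single 0]
  · simp only [Fin.val_zero, pow_zero, one_mul, Matrix.of_apply, cons_val_zero, Pi.single_eq_same]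
    congr 1
  · intro j _ hj
    simp [hj]
  · simp

lemma det_extend_eq_stairDet (h : ℤ → K) (hneg : ∀ k < 0, h k = 0) (h0 : h 0 = 1) (n : ℕ) :
    Matrix.det (Matrix.of fun i j : Fin (n + 1) => h ((n : ℤ) + (i : ℕ) - 2 * (j : ℕ)))
      = stairDet h n := by
  rw [Matrix.det_succ_column _ (Fin.last n), Finset.sum_eq_single (Fin.last n)]
  · have e : (n : ℤ) + n - 2 * n = 0 := by ring
    simp only [Matrix.of_apply, Fin.val_last, e, h0, stairDet]
    rw [← two_mul, pow_mul]
    simp only [even_two, Even.neg_pow, one_pow, one_mul]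
    congr 1
    ext i j
    simp
  · intro j _ hj
    have : (j : ℕ) < n := Fin.val_lt_last hj
    simp only [Matrix.of_apply, Fin.val_last]
    rw [hneg _ (by omega)]
    simp
  · simp

/-- Adding multiples of the preceding rows to all rows but the first. -/
lemma det_shiftSeq_rows {n : ℕ} (g : ℤ → K) (c : K) (s : ℤ) (t : Fin (n + 1) → ℤ) :
    Matrix.det (Matrix.of fun i j : Fin (n + 1) => g (s + (i : ℕ) - t j))
      = Matrix.det (Matrix.of (vecCons (fun j => g (s - t j))
          fun (i : Fin n) j => shiftSeq c g (s + 1 + (i : ℕ) - t j))) := by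
  refine Matrix.det_eq_of_forall_row_eq_smul_add_pred (fun _ => -c) ?_ ?_
  · intro j; simp
  · intro i j
    simp only [Matrix.of_apply, cons_val_succ, shiftSeq, Fin.val_succ, Fin.val_castSucc]
    push_cast
    rw [show s + 1 + (i : ℤ) - t j - 1 = s + i - t j by ring,
      show s + ((i : ℤ) + 1) - t j = s + 1 + i - t j by ring]
    ring

/-- Adding multiples of the preceding rows to all rows but the first two. -/
lemma det_vecCons_shiftSeq_rows {n : ℕ} (g : ℤ → K) (c : K) (s : ℤ) (t : Fin (n + 2) → ℤ)
    (α : Fin (n + 2) → K) :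
    Matrix.det (Matrix.of (vecCons α fun (i : Fin (n + 1)) j => g (s + (i : ℕ) - t j)))
      = twoRowDet (fun (i : Fin n) j => shiftSeq c g (s + 1 + (i : ℕ) - t j)) α
          (fun j => g (s - t j)) := by
  refine Matrix.det_eq_of_forall_row_eq_smul_add_pred (vecCons 0 fun _ => -c) ?_ ?_
  · intro j; simp
  · intro i j
    refine Fin.cases ?_ (fun i => ?_) i
    · simp
    · simp only [Matrix.of_apply, cons_val_succ, shiftSeq, Fin.val_succ, Fin.castSucc_succ,
        Fin.val_castSucc]
      push_cast
      rw [show s + 1 + (i : ℤ) - t j - 1 = s + i - t j by ring,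
        show s + ((i : ℤ) + 1) - t j = s + 1 + i - t j by ring]
      ring

lemma shiftSeq_comm (a c : K) (h : ℤ → K) :
    shiftSeq a (shiftSeq c h) = shiftSeq c (shiftSeq a h) := by
  funext k
  simp only [shiftSeq]
  ring

lemma shiftSeq_neg (c : K) (h : ℤ → K) (hneg : ∀ k < 0, h k = 0) :
    ∀ k < 0, shiftSeq c h k = 0 := by
  intro k hk
  simp [shiftSeq, hneg k hk, hneg (k - 1) (by omega)]

lemma shiftSeq_zero (c : K) (h : ℤ → K) (hneg : ∀ k < 0, h k = 0) (h0 : h 0 = 1) :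
    shiftSeq c h 0 = 1 := by
  simp [shiftSeq, h0, hneg (-1) (by omega)]

/-- The bilinear lattice equation for staircase determinants with generating functions
multiplied by linear factors. -/
lemma stairDet_bilinear (h : ℤ → K) (hneg : ∀ k < 0, h k = 0) (h0 : h 0 = 1) (a c : K) (n : ℕ) :
    stairDet (shiftSeq c h) (n + 1) * stairDet (shiftSeq a h) (n - 1)
        - stairDet (shiftSeq c h) (n - 1) * stairDet (shiftSeq a h) (n + 1)
      = (c - a) * stairDet (shiftSeq c (shiftSeq a h)) n * stairDet h n := by
  obtain _ | m := n
  · simp [stairDet, shiftSeq, h0]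
  set t : Fin (m + 2) → ℤ := fun j => 2 * ((j : ℕ) : ℤ) with ht
  set x := shiftSeq c (shiftSeq a h) with hx
  set X : Fin m → Fin (m + 2) → K := fun i j => x ((m : ℤ) + 2 + 1 + (i : ℕ) - t j) with hX
  set L : Fin (m + 2) → K := fun j => x ((m : ℤ) + 2 + 1 + (m : ℕ) - t j) with hL
  set w : Fin (m + 2) → K := fun j => shiftSeq c h ((m : ℤ) + 2 - t j) with hw
  set u : Fin (m + 2) → K := fun j => shiftSeq a h ((m : ℤ) + 2 - t j) with hu
  obtain ⟨σ, hσ, hσL⟩ := twoRowDet_eq_sign_mul_snoc X L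
  have hsnoc : Fin.snoc (α := fun _ => Fin (m + 2) → K) X L
      = fun (i : Fin (m + 1)) j => x ((m : ℤ) + 2 + 1 + (i : ℕ) - t j) := by
    funext i
    refine Fin.lastCases ?_ (fun i => ?_) i
    · simp [hL]
    · simp [hX]
  rw [hsnoc] at hσL
  have big : ∀ (g : ℤ → K) (b : K), shiftSeq b g = x →
      twoRowDet X (fun j => g ((m : ℤ) + 2 - t j)) L = σ * stairDet g (m + 1 + 1) := by
    intro g b hg
    rw [hσL, ← hg, ← det_shiftSeq_rows]
    simp [stairDet, ht, add_assoc]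
  have small : ∀ (g : ℤ → K) (b : K), shiftSeq b g = x → (∀ k < 0, g k = 0) → g 0 = 1 →
      twoRowDet X (Pi.single 0 1) (fun j => g ((m : ℤ) + 2 - t j)) = stairDet g (m + 1 - 1) := by
    intro g b hg hgn hg0
    rw [hX, ← hg, ← det_vecCons_shiftSeq_rows, det_vecCons_single, Nat.add_sub_cancel,
      ← det_extend_eq_stairDet g hgn hg0]
    congr 2
    ext i j
    simp only [ht, Fin.val_succ]
    congr 1
    push_cast
    ring
  have hxu : shiftSeq c (shiftSeq a h) = x := rfl
  have hxw : shiftSeq a (shiftSeq c h) = x := shiftSeq_comm a c h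
  have eL : twoRowDet X (Pi.single 0 1) L = σ * stairDet x (m + 1) := by
    rw [hσL, det_vecCons_single]
    congr 3
    ext i j
    simp only [ht, Fin.val_succ]
    congr 1
    push_cast
    ring
  have ewu : twoRowDet X w u = (c - a) * stairDet h (m + 1) := by
    rw [← det_extend_eq_stairDet h hneg h0]
    have e := det_shiftSeq_rows (n := m + 1) h a ((m + 1 : ℕ) : ℤ) t
    rw [det_vecCons_shiftSeq_rows _ c] at e
    have hs : ((m + 1 : ℕ) : ℤ) + 1 = (m : ℤ) + 2 := by push_cast; ring
    rw [hs] at e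
    change _ = (c - a) * Matrix.det (Matrix.of fun i j : Fin (m + 1 + 1) =>
      h (((m + 1 : ℕ) : ℤ) + (i : ℕ) - t j))
    rw [e]
    have hwv : w = ∑ i : Fin 2, (![1, c - a] : Fin 2 → K) i •
        (![u, fun j => h (((m + 1 : ℕ) : ℤ) - t j)] : Fin 2 → Fin (m + 2) → K) i := by
      ext j
      simp only [hw, hu, Fin.sum_univ_two, shiftSeq]
      simp
      rw [show (m : ℤ) + 2 - t j - 1 = m + 1 - t j by ring]
      ring
    unfold twoRowDet
    rw [hwv, det_vecCons_sum, Fin.sum_univ_two]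
    have hz : Matrix.det (Matrix.of (vecCons u (vecCons u X))) = 0 :=
      Matrix.det_zero_of_row_eq (i := 0) (j := Fin.succ 0) (Fin.succ_ne_zero _).symm
        (by ext; simp)
    simp only [cons_val_zero, cons_val_one, hz, mul_zero, zero_add]
    rfl
  have pl := twoRowDet_plucker X w L (Pi.single 0 1) u
  rw [twoRowDet_swap X w (Pi.single 0 1), twoRowDet_swap X L u,
    twoRowDet_swap X L (Pi.single 0 1), ewu, eL, big _ c hxu, big _ a hxw,
    small _ c hxu (shiftSeq_neg a h hneg) (shiftSeq_zero a h hneg h0),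
    small _ a hxw (shiftSeq_neg c h hneg) (shiftSeq_zero c h hneg h0)] at pl
  apply mul_left_cancel₀ hσ
  linear_combination pl

lemma exists_stairDet_scale (q : K) (hq : q ≠ 0) :
    ∃ E : ℕ → K, (∀ n, E (n + 1) = q ^ (n + 1) * E n) ∧
      ∀ (h : ℤ → K) (n : ℕ), stairDet (fun k => q ^ k * h k) n = E n * stairDet h n := by
  refine ⟨fun n => ∏ j : Fin n, q ^ ((n : ℤ) - (j : ℕ)), fun n => ?_, fun h n => ?_⟩
  · beta_reduce
    rw [Fin.prod_univ_succ]
    congr 1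
    · simp only [Fin.val_zero, Nat.cast_zero, sub_zero]
      exact zpow_natCast q (n + 1)
    · refine Finset.prod_congr rfl fun j _ => ?_
      congr 1
      simp only [Fin.val_succ]
      push_cast
      ring
  · have e : (Matrix.of fun i j : Fin n => q ^ ((n : ℤ) + (i : ℕ) - 2 * (j : ℕ))
          * h ((n : ℤ) + (i : ℕ) - 2 * (j : ℕ)))
        = Matrix.of fun i j : Fin n => q ^ ((n : ℤ) + (i : ℕ)) *
          (Matrix.of fun i j : Fin n => q ^ (-2 * ((j : ℕ) : ℤ)) *
            (Matrix.of fun i j : Fin n => h ((n : ℤ) + (i : ℕ) - 2 * (j : ℕ))) i j) i j := by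
      ext i j
      simp only [Matrix.of_apply]
      rw [← mul_assoc, ← zpow_add₀ hq]
      congr 2
    unfold stairDet
    rw [e, Matrix.det_mul_column, Matrix.det_mul_row, ← mul_assoc, ← Finset.prod_mul_distrib]
    congr 1
    refine Finset.prod_congr rfl fun j _ => ?_
    rw [← zpow_add₀ hq]
    ring_nf

end Determinants

section Signs

variable {K : Type*} [Field K]

lemma phi_natCast (p : ℤ → K → K → K) (n : ℕ) (y z : K) : phi p n y z = phiAux p n y z := by
  simp [phi]

lemma phi_natCast_sub_one (p : ℤ → K → K → K) (n : ℕ) (y z : K) :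
    phi p ((n : ℤ) - 1) y z = phiAux p (n - 1) y z := by
  obtain _ | n := n
  · simp [phi]
  · simpa using phi_natCast p n y z

lemma phi_neg_sub_one (p : ℤ → K → K → K) (n : ℕ) (y z : K) :
    phi p (-(n : ℤ) - 1) y z = (-1) ^ (n * (n + 1) / 2) * phiAux p n y z := by
  have hexp : (-(n : ℤ) - 1) * (-(n : ℤ) - 1 + 1) / 2 = ((n * (n + 1) / 2 : ℕ) : ℤ) := by
    push_cast
    congr 1
    ring
  rw [phi, if_neg (by omega), hexp, zpow_natCast]
  congr 2
  omega

lemma phi_neg (p : ℤ → K → K → K) (n : ℕ) (y z : K) :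
    phi p (-(n : ℤ)) y z = (-1) ^ (n * (n - 1) / 2) * phiAux p (n - 1) y z := by
  obtain _ | n := n
  · simp [phi]
  · rw [show (-((n + 1 : ℕ) : ℤ)) = -(n : ℤ) - 1 by push_cast; ring, phi_neg_sub_one,
      Nat.add_sub_cancel, mul_comm n]

lemma neg_one_pow_triangle_mul (n : ℕ) :
    ((-1 : K) ^ ((n + 1) * (n + 1 + 1) / 2)) * (-1) ^ (n * (n - 1) / 2) = -1 := by
  rw [← pow_add]
  apply Odd.neg_one_pow
  obtain _ | n := n
  · exact ⟨0, by norm_num⟩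
  · obtain ⟨a, ha⟩ := (Nat.even_mul_succ_self n).two_dvd
    have h1 : (n + 1 + 1) * (n + 1 + 1 + 1) = 2 * (a + 2 * n + 3) := by
      linear_combination ha
    have h2 : (n + 1) * (n + 1 - 1) = 2 * a := by
      rw [Nat.add_sub_cancel, mul_comm]; exact ha
    rw [h1, h2, Nat.mul_div_cancel_left _ two_pos, Nat.mul_div_cancel_left _ two_pos]
    exact ⟨a + n + 1, by ring⟩

end Signs

theorem bilinear_bl8
    {K : Type*} [Field K] (q : K) (hq0 : q ≠ 0)
    (hq1 : ∀ k : ℕ, 1 ≤ k → q ^ k ≠ 1)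
    (p : ℤ → K → K → K)
    (hp_neg : ∀ k : ℤ, k < 0 → ∀ y z : K, p k y z = 0)
    (hp_zero : ∀ y z : K, p 0 y z = 1)
    (hC1 : ∀ k : ℕ, 1 ≤ k → ∀ y z : K,
      (∑ i ∈ Finset.range k, q ^ i) * p (k : ℤ) y z
        = (y + z + q ^ (k - 1)) * p ((k : ℤ) - 1) y z
          - (1 - q) * y * z * p ((k : ℤ) - 2) y z)
    (hC2 : ∀ (k : ℤ) (y z : K), p k y (q * z) - p k y z = (q - 1) * z * p (k - 1) y z)
    (hC3 : ∀ (k : ℤ) (y z : K), p k (q * y) z - p k y z = (q - 1) * y * p (k - 1) y z)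
    (N : ℤ) (y z : K) :
    q ^ (-2 * (N + 1)) * y * phi p N (y / q) z * phi p N y z
      + q ^ (-(N + 1)) * (1 + z) * phi p N y (q * z) * phi p N (y / q) (z / q)
    = -((1 - q ^ (-(2 * N + 1))) / (1 - q)) * phi p (N - 1) y z * phi p (N + 1) (y / q) z := by
  have hq1' : (1 : K) - q ≠ 0 := fun h => hq1 1 le_rfl (by rw [pow_one]; linear_combination -h)
  set h : ℤ → K := fun k => p k (y / q) (z / q) with hh
  set a : K := (q - 1) * z / q with ha
  set b : K := (q - 1) * y / q with hb
  set c : K := (1 - q) / q with hc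
  have hneg : ∀ k < 0, h k = 0 := fun k hk => hp_neg k hk _ _
  have h0 : h 0 = 1 := hp_zero _ _
  have hu : (fun k => p k (y / q) z) = shiftSeq a h := by
    funext k
    have := hC2 k (y / q) (z / q)
    rw [mul_div_cancel₀ z hq0] at this
    simp only [shiftSeq, hh, ha]
    linear_combination this
  have hP : (fun k => p k y z) = shiftSeq b (shiftSeq a h) := by
    rw [← hu]
    funext k
    have := hC3 k (y / q) z
    rw [mul_div_cancel₀ y hq0] at this
    simp only [shiftSeq, hb]
    linear_combination this
  have hPw : (fun k => p k y z) = fun k => q ^ k * shiftSeq c h k := by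
    rw [hP]
    funext k
    rcases lt_trichotomy k 0 with hk | rfl | hk
    · rw [shiftSeq_neg _ _ (shiftSeq_neg _ _ hneg) k hk, shiftSeq_neg _ _ hneg k hk, mul_zero]
    · rw [shiftSeq_zero _ _ (shiftSeq_neg _ _ hneg) (shiftSeq_zero _ _ hneg h0),
        shiftSeq_zero _ _ hneg h0]
      simp
    · lift k to ℕ using hk.le
      obtain ⟨n, rfl⟩ : ∃ n, k = n + 1 := ⟨k - 1, by omega⟩
      have e := hC1 (n + 1) (by omega) (y / q) (z / q)
      have g := geom_sum_mul q (n + 1)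
      change _ * h _ = _ * h _ - _ * h _ at e
      simp only [shiftSeq, zpow_natCast, Nat.add_sub_cancel] at e ⊢
      rw [show (((n + 1 : ℕ) : ℤ) - 1 - 1) = ((n + 1 : ℕ) : ℤ) - 2 by ring]
      generalize h ((n + 1 : ℕ) : ℤ) = A at *
      generalize h (((n + 1 : ℕ) : ℤ) - 1) = B at *
      generalize h (((n + 1 : ℕ) : ℤ) - 2) = C at *
      generalize ∑ i ∈ Finset.range (n + 1), q ^ i = S at *
      rw [ha, hb, hc]
      have e' : (1 - q ^ (n + 1)) * A = (1 - q) * ((y / q + z / q + q ^ n) * B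
          - (1 - q) * (y / q) * (z / q) * C) := by
        linear_combination (1 - q) * e + A * g
      field_simp at e' ⊢
      ring_nf at e' ⊢
      linear_combination e'
  have hx : (fun k => p k y (q * z)) = fun k => q ^ k * shiftSeq c (shiftSeq a h) k := by
    funext k
    have e := hC2 k y z
    have e1 : p k y z = _ := congrFun hPw k
    have e2 : p (k - 1) y z = _ := congrFun hPw (k - 1)
    have hqk : q ^ k = q ^ (k - 1) * q := by
      rw [← zpow_add_one₀ hq0]; congr 1; ring
    rw [← shiftSeq_comm]
    simp only [shiftSeq] at e1 e2 ⊢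
    have hqa : q * a = (q - 1) * z := by rw [ha]; field_simp
    rw [e1, e2, hqk] at e
    rw [hqk]
    linear_combination e - q ^ (k - 1) * (h (k - 1) + c * h (k - 1 - 1)) * hqa
  obtain ⟨E, hE, hEs⟩ := exists_stairDet_scale q hq0
  have hca : q * (c - a) = (1 - q) * (1 + z) := by rw [hc, ha]; field_simp; ring
  have hqb : q * b = (q - 1) * y := by rw [hb]; field_simp
  have R1 : ∀ n : ℕ, phiAux p (n + 1) y z * phiAux p (n - 1) (y / q) z
      - phiAux p (n - 1) y z * phiAux p (n + 1) (y / q) z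
      = b * phiAux p n y z * phiAux p n (y / q) z := by
    intro n
    simp only [phiAux_eq_stairDet, hP, hu]
    have := stairDet_bilinear (shiftSeq a h) (shiftSeq_neg _ _ hneg) (shiftSeq_zero _ _ hneg h0)
      0 b n
    have hz : ∀ g : ℤ → K, shiftSeq 0 g = g := fun g => by funext k; simp [shiftSeq]
    simpa only [hz, sub_zero] using this
  have R2 : ∀ n : ℕ, phiAux p (n + 1) y z * phiAux p (n - 1) (y / q) z
      - q ^ (2 * n + 1) * phiAux p (n - 1) y z * phiAux p (n + 1) (y / q) z
      = (1 - q) * (1 + z) * q ^ n * phiAux p n y (q * z) * phiAux p n (y / q) (z / q) := by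
    intro n
    simp only [phiAux_eq_stairDet, hPw, hu, hx, hEs]
    have key := stairDet_bilinear h hneg h0 a c n
    change _ = _ * stairDet h n
    have hE2 : E (n + 1) = q ^ (2 * n + 1) * E (n - 1) := by
      obtain _ | n := n
      · simpa using hE 0
      · rw [hE, hE, Nat.add_sub_cancel]; ring
    linear_combination E (n + 1) * key + stairDet (shiftSeq c h) (n - 1) * stairDet (shiftSeq a h) (n + 1) * hE2 + stairDet (shiftSeq c (shiftSeq a h)) n * stairDet h n * ((c - a) * hE n + q ^ n * E n * hca)
  rcases le_or_gt 0 N with hN | hN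
  · lift N to ℕ using hN
    rw [phi_natCast_sub_one, show (N : ℤ) + 1 = ((N + 1 : ℕ) : ℤ) by push_cast; ring]
    simp only [phi_natCast]
    have r1 := R1 N
    have r2 := R2 N
    rw [show (-2 * ((N + 1 : ℕ) : ℤ)) = -((2 * (N + 1) : ℕ) : ℤ) by push_cast; ring,
      show (2 * (N : ℤ) + 1) = ((2 * N + 1 : ℕ) : ℤ) by push_cast; ring]
    simp only [_root_.zpow_neg, zpow_natCast]
    generalize phiAux p (N + 1) y z = A1 at *
    generalize phiAux p (N - 1) y z = A2 at *
    generalize phiAux p N y z = A3 at *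
    generalize phiAux p (N + 1) (y / q) z = A4 at *
    generalize phiAux p (N - 1) (y / q) z = A5 at *
    generalize phiAux p N (y / q) z = A6 at *
    generalize phiAux p N y (q * z) = A7 at *
    generalize phiAux p N (y / q) (z / q) = A8 at *
    have main : y * A6 * A3 * (1 - q) + q ^ (N + 1) * (1 + z) * A7 * A8 * (1 - q)
        = q * (1 - q ^ (2 * N + 1)) * A2 * A4 := by
      linear_combination q * r1 - q * r2 + A6 * A3 * hqb
    have hL : (q ^ (2 * (N + 1)))⁻¹ * y * A6 * A3 + (q ^ (N + 1))⁻¹ * (1 + z) * A7 * A8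
        = (y * A6 * A3 * (1 - q) + q ^ (N + 1) * (1 + z) * A7 * A8 * (1 - q))
          / ((1 - q) * q ^ (2 * (N + 1))) := by
      field_simp
      ring
    rw [hL, main]
    field_simp
    ring
  · obtain ⟨n, rfl⟩ : ∃ n : ℕ, N = -(n : ℤ) - 1 := ⟨(-N - 1).toNat, by omega⟩
    rw [show -(n : ℤ) - 1 - 1 = -((n + 1 : ℕ) : ℤ) - 1 by push_cast; ring,
      show -(n : ℤ) - 1 + 1 = -(n : ℤ) by ring, phi_neg]
    simp only [phi_neg_sub_one]
    have r1 := R1 n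
    have r2 := R2 n
    rw [show -2 * -(n : ℤ) = ((2 * n : ℕ) : ℤ) by push_cast; ring,
      show -(2 * (-(n : ℤ) - 1) + 1) = ((2 * n + 1 : ℕ) : ℤ) by push_cast; ring, neg_neg]
    simp only [zpow_natCast]
    have s1 := neg_one_pow_triangle_mul (K := K) n
    have s2 : ((-1 : K) ^ (n * (n + 1) / 2)) * (-1) ^ (n * (n + 1) / 2) = 1 := by
      rw [← mul_pow]; simp
    generalize phiAux p (n + 1) y z = A1 at *
    generalize phiAux p (n - 1) y z = A2 at *
    generalize phiAux p n y z = A3 at *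
    generalize phiAux p (n + 1) (y / q) z = A4 at *
    generalize phiAux p (n - 1) (y / q) z = A5 at *
    generalize phiAux p n (y / q) z = A6 at *
    generalize phiAux p n y (q * z) = A7 at *
    generalize phiAux p n (y / q) (z / q) = A8 at *
    generalize (-1 : K) ^ (n * (n + 1) / 2) = s at *
    generalize (-1 : K) ^ ((n + 1) * (n + 1 + 1) / 2) = s' at *
    generalize (-1 : K) ^ (n * (n - 1) / 2) = s'' at *
    have main : (1 - q) * (q ^ (2 * n) * y * A6 * A3 + q ^ n * (1 + z) * A7 * A8)
        = (1 - q ^ (2 * n + 1)) * A1 * A5 := by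
      linear_combination q ^ (2 * n + 1) * r1 - r2 + q ^ (2 * n) * A6 * A3 * hqb
    have e : -((1 - q ^ (2 * n + 1)) / (1 - q)) * (s' * A1) * (s'' * A5)
        = (1 - q ^ (2 * n + 1)) * A1 * A5 / (1 - q) := by
      linear_combination (-(1 - q ^ (2 * n + 1)) / (1 - q) * A1 * A5) * s1
    rw [e, ← main, mul_div_cancel_left₀ _ hq1']
    linear_combination (q ^ (2 * n) * y * A6 * A3 + q ^ n * (1 + z) * A7 * A8) * s2
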